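/- Two complete isotropic flags V_• = (V_1 ⊂ … ⊂ V_{n+1}) and V′_• = (V′_1 ⊂ … ⊂ V′_{n+1}) of E lie in the same orbit of B if and only if dim(V_i ∩ E_j) = dim(V′_i ∩ E_j) for all 1 ≤ i ≤ n+1 and all 1 ≤ j ≤ 2n+1. (Hence the Schubert cells of the odd symplectic flag manifold, defined by incidence conditions, are exactly the B-orbits.) -/

import Mathlib

open Module Submodule

noncomputable section

variable {E : Type*} [AddCommGroup E] [Module ℂ E]

/-- A subspace is isotropic for a bilinear form. -/
def IsIsotropic (ω : LinearMap.BilinForm ℂ E) (V : Submodule ℂ E) : Prop :=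
  ∀ x ∈ V, ∀ y ∈ V, ω x y = 0

/-- The group of linear automorphisms preserving a bilinear form
(the odd symplectic group of the form). -/
def sympGroup (ω : LinearMap.BilinForm ℂ E) : Subgroup (E ≃ₗ[ℂ] E) where
  carrier := {g | ∀ x y : E, ω (g x) (g y) = ω x y}
  one_mem' := fun _ _ => rfl
  mul_mem' := by
    intro a b ha hb x y
    simp only [Set.mem_setOf_eq] at ha hb ⊢
    rw [show (a * b) x = a (b x) from rfl, show (a * b) y = a (b y) from rfl, ha, hb]
  inv_mem' := by
    intro a ha x y
    simp only [Set.mem_setOf_eq] at ha ⊢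
    have h1 : a ((a⁻¹ : E ≃ₗ[ℂ] E) x) = x := a.apply_symm_apply x
    have h2 : a ((a⁻¹ : E ≃ₗ[ℂ] E) y) = y := a.apply_symm_apply y
    calc ω ((a⁻¹ : E ≃ₗ[ℂ] E) x) ((a⁻¹ : E ≃ₗ[ℂ] E) y)
        = ω (a ((a⁻¹ : E ≃ₗ[ℂ] E) x)) (a ((a⁻¹ : E ≃ₗ[ℂ] E) y)) := (ha _ _).symm
      _ = ω x y := by rw [h1, h2]

/-- The reference flag: `Efl j = span(e₀, …, e_{j−1})` (so `Efl 0 = 0`). -/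
def Efl (n : ℕ) (e : Basis (Fin (2 * n + 1)) ℂ E) (j : ℕ) : Submodule ℂ E :=
  Submodule.span ℂ (e '' {i : Fin (2 * n + 1) | (i : ℕ) < j})

/-- A complete isotropic flag `V₁ ⊂ … ⊂ V_{n+1}` of `E` (indexed so that `V i` has
dimension `i+1`). -/
def IsIsoFlag (n : ℕ) (ω : LinearMap.BilinForm ℂ E)
    (V : Fin (n + 1) → Submodule ℂ E) : Prop :=
  (∀ i j : Fin (n + 1), i ≤ j → V i ≤ V j) ∧
  (∀ i : Fin (n + 1), finrank ℂ (V i) = (i : ℕ) + 1) ∧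
  (∀ i : Fin (n + 1), IsIsotropic ω (V i))

section BorelOrbits

variable {n : ℕ} {ω : LinearMap.BilinForm ℂ E} {e : Basis (Fin (2 * n + 1)) ℂ E}

/-- The elements of the odd symplectic group stabilizing the reference flag. -/
def borelGroup (n : ℕ) (ω : LinearMap.BilinForm ℂ E) (e : Basis (Fin (2 * n + 1)) ℂ E) :
    Subgroup (E ≃ₗ[ℂ] E) where
  carrier := {g | g ∈ sympGroup ω ∧ ∀ j : ℕ, j ≤ 2 * n + 1 →
    Submodule.map (g : E →ₗ[ℂ] E) (Efl n e j) = Efl n e j}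
  one_mem' := ⟨one_mem _, fun j _ => Submodule.map_id (Efl n e j)⟩
  mul_mem' := by
    rintro a b ⟨ha, ha'⟩ ⟨hb, hb'⟩
    refine ⟨mul_mem ha hb, fun j hj => ?_⟩
    rw [show ((a * b : E ≃ₗ[ℂ] E) : E →ₗ[ℂ] E) = (a : E →ₗ[ℂ] E) ∘ₗ (b : E →ₗ[ℂ] E) from rfl,
      Submodule.map_comp, hb' j hj, ha' j hj]
  inv_mem' := by
    rintro a ⟨ha, ha'⟩
    refine ⟨inv_mem ha, fun j hj => ?_⟩
    conv_lhs => rw [← ha' j hj, ← Submodule.map_comp]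
    rw [show ((a⁻¹ : E ≃ₗ[ℂ] E) : E →ₗ[ℂ] E) ∘ₗ (a : E →ₗ[ℂ] E) = LinearMap.id from
      LinearMap.ext fun x => a.symm_apply_apply x, Submodule.map_id]

lemma mem_Efl_iff {j : ℕ} {x : E} :
    x ∈ Efl n e j ↔ ∀ k : Fin (2 * n + 1), j ≤ (k : ℕ) → e.repr x k = 0 := by
  rw [Efl, Basis.mem_span_image]
  simp only [Set.subset_def, Finset.mem_coe, Finsupp.mem_support_iff, Set.mem_ofPred_eq]
  refine forall_congr' fun k => ?_
  rw [← not_lt, not_imp_comm]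

lemma Efl_mono {i j : ℕ} (h : i ≤ j) : Efl n e i ≤ Efl n e j :=
  Submodule.span_mono (Set.image_mono fun _ hk => lt_of_lt_of_le hk h)

lemma Efl_eq_top : Efl n e (2 * n + 1) = ⊤ :=
  eq_top_iff.2 fun _ _ => mem_Efl_iff.2 fun k hk => absurd k.2 (not_lt.2 hk)

lemma map_Efl_of_unitriangular {f : E →ₗ[ℂ] E}
    (hf : ∀ k : Fin (2 * n + 1), f (e k) - e k ∈ Efl n e k) (j : ℕ) :
    Submodule.map f (Efl n e j) = Efl n e j := by
  apply le_antisymm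
  · rw [Efl, Submodule.map_span, Submodule.span_le]
    rintro _ ⟨_, ⟨k, hk, rfl⟩, rfl⟩
    have h1 : e k ∈ Efl n e j := Submodule.subset_span ⟨k, hk, rfl⟩
    have h2 := add_mem (Efl_mono (le_of_lt hk) (hf k)) h1
    rwa [sub_add_cancel] at h2
  · induction j with
    | zero => simp [Efl]
    | succ j ih =>
      conv_lhs => rw [Efl]
      rw [Submodule.span_le]
      rintro _ ⟨k, hk, rfl⟩
      have hk : (k : ℕ) < j + 1 := hk
      have h1 : f (e k) ∈ Submodule.map f (Efl n e (j + 1)) :=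
        Submodule.mem_map_of_mem (Submodule.subset_span ⟨k, hk, rfl⟩)
      have h2 : f (e k) - e k ∈ Submodule.map f (Efl n e (j + 1)) :=
        Submodule.map_mono (Efl_mono j.le_succ) (ih (Efl_mono (by omega) (hf k)))
      have h3 := sub_mem h1 h2
      rwa [sub_sub_cancel] at h3

lemma exists_borel_of_unitriangular {b : Fin (2 * n + 1) → E}
    (hb : ∀ k : Fin (2 * n + 1), b k - e k ∈ Efl n e k) (hω : ∀ i j, ω (b i) (b j) = ω (e i) (e j)) :
    ∃ g ∈ borelGroup n ω e, ∀ k, g (e k) = b k := by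
  have : FiniteDimensional ℂ E := e.finiteDimensional_of_finite
  set f : E →ₗ[ℂ] E := e.constr ℂ b with hf
  have hfe : ∀ k, f (e k) = b k := fun k => e.constr_basis ℂ b k
  have hmap := map_Efl_of_unitriangular (f := f) (e := e) (fun k => by rw [hfe]; exact hb k)
  have hsurj : Function.Surjective f := by
    rw [← LinearMap.range_eq_top, LinearMap.range_eq_map]
    simpa only [Efl_eq_top] using hmap (2 * n + 1)
  have hinj : Function.Injective f := LinearMap.injective_iff_surjective.2 hsurj
  have hsymp : ω.compl₁₂ f f = ω := e.ext fun i => e.ext fun j => by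
    simp only [LinearMap.compl₁₂_apply, hfe, hω]
  exact ⟨LinearEquiv.ofBijective f ⟨hinj, hsurj⟩,
    ⟨fun x y => LinearMap.congr_fun₂ hsymp x y, fun j _ => hmap j⟩, hfe⟩

lemma form_basis_eq_zero (halt : ω.IsAlt)
    (he : ∀ i j : Fin (2 * n + 1), (i : ℕ) < (j : ℕ) →
      ω (e i) (e j) = if (i : ℕ) + (j : ℕ) = 2 * n + 1 then 1 else 0)
    {i j : Fin (2 * n + 1)} (hij : (i : ℕ) + (j : ℕ) ≠ 2 * n + 1) : ω (e i) (e j) = 0 := by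
  rcases lt_trichotomy (i : ℕ) (j : ℕ) with h | h | h
  · rw [he i j h, if_neg hij]
  · rw [Fin.ext h]; exact halt _
  · rw [← halt.neg_eq, he j i h, if_neg (by omega), neg_zero]

lemma form_basis_ne_zero (halt : ω.IsAlt)
    (he : ∀ i j : Fin (2 * n + 1), (i : ℕ) < (j : ℕ) →
      ω (e i) (e j) = if (i : ℕ) + (j : ℕ) = 2 * n + 1 then 1 else 0)
    {i j : Fin (2 * n + 1)} (hij : (i : ℕ) + (j : ℕ) = 2 * n + 1) : ω (e i) (e j) ≠ 0 := by
  rcases lt_trichotomy (i : ℕ) (j : ℕ) with h | h | h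
  · rw [he i j h, if_pos hij]; exact one_ne_zero
  · omega
  · rw [← halt.neg_eq, he j i h, if_pos (by omega)]; exact neg_ne_zero.2 one_ne_zero

lemma form_basis_left (halt : ω.IsAlt)
    (he : ∀ i j : Fin (2 * n + 1), (i : ℕ) < (j : ℕ) →
      ω (e i) (e j) = if (i : ℕ) + (j : ℕ) = 2 * n + 1 then 1 else 0)
    {i j : Fin (2 * n + 1)} (hij : (i : ℕ) + (j : ℕ) = 2 * n + 1) (v : E) :
    ω (e i) v = e.repr v j * ω (e i) (e j) := by
  conv_lhs => rw [← e.sum_repr v]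
  rw [map_sum, Finset.sum_eq_single j]
  · simp
  · intro k _ hk
    rw [map_smul, form_basis_eq_zero halt he, smul_zero]
    intro h
    exact hk (Fin.ext (by omega))
  · simp

/-- A vector with leading basis vector `e m`, `m ≠ 0`, is the image of `e m` under an element of
the Borel subgroup which fixes the basis vectors orthogonal to it other than `e m`. -/
lemma exists_borel_map_basis (halt : ω.IsAlt)
    (he : ∀ i j : Fin (2 * n + 1), (i : ℕ) < (j : ℕ) →
      ω (e i) (e j) = if (i : ℕ) + (j : ℕ) = 2 * n + 1 then 1 else 0)
    {m : Fin (2 * n + 1)} (hm : 0 < (m : ℕ)) {v : E} (hvm : v - e m ∈ Efl n e m) :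
    ∃ g ∈ borelGroup n ω e, g (e m) = v ∧ ∀ k, k ≠ m → ω (e k) v = 0 → g (e k) = e k := by
  obtain ⟨p, hp⟩ : ∃ p : Fin (2 * n + 1), (p : ℕ) + (m : ℕ) = 2 * n + 1 :=
    ⟨⟨2 * n + 1 - m, by omega⟩, by simp only; omega⟩
  have hpm : p ≠ m := by rintro rfl; omega
  have hm1 : e.repr v m = 1 := by
    have := mem_Efl_iff.1 hvm m le_rfl
    simpa [sub_eq_zero] using this
  have hgt : ∀ k : Fin (2 * n + 1), (m : ℕ) < k → e.repr v k = 0 := fun k hk => by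
    have hkm : m ≠ k := by rintro rfl; omega
    simpa [Finsupp.single_apply, hkm] using mem_Efl_iff.1 hvm k hk.le
  have hpv : ω (e p) v = ω (e p) (e m) := by rw [form_basis_left halt he hp, hm1, one_mul]
  have hpv0 : ω (e p) v ≠ 0 := hpv ▸ form_basis_ne_zero halt he hp
  have hvp : ω v (e p) = ω (e m) (e p) := by rw [← halt.neg_eq, hpv, halt.neg_eq]
  have horth : ∀ k, k ≠ m → ω (e p) (e k) = 0 := fun k hk =>
    form_basis_eq_zero halt he fun h => hk (Fin.ext (by omega))
  have horth' : ∀ k, k ≠ m → ω (e k) (e p) = 0 := fun k hk => by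
    rw [← halt.neg_eq, horth k hk, neg_zero]
  have horthm : ∀ k, k ≠ p → ω (e k) (e m) = 0 := fun k hk =>
    form_basis_eq_zero halt he fun h => hk (Fin.ext (by omega))
  set c : Fin (2 * n + 1) → ℂ := fun k => if k = p then 0 else ω (e k) v / ω (e p) v with hc
  set b : Fin (2 * n + 1) → E := fun k => if k = m then v else e k - c k • e p with hb
  have hbm : b m = v := if_pos rfl
  have hbk : ∀ k, k ≠ m → b k = e k - c k • e p := fun k hk => if_neg hk
  have hbv : ∀ k, k ≠ m → ω (b k) v = ω (e k) (e m) := by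
    intro k hk
    rw [hbk k hk]
    by_cases hkp : k = p
    · subst hkp
      simp [hc, hpv]
    · rw [horthm k hkp]
      simp [hc, hkp, hpv0]
  have htri : ∀ k : Fin (2 * n + 1), b k - e k ∈ Efl n e k := by
    intro k
    by_cases hk : k = m
    · rw [hk, hbm]; exact hvm
    · rw [hbk k hk, sub_sub_cancel_left]
      refine neg_mem ?_
      by_cases hck : c k = 0
      · rw [hck, zero_smul]; exact zero_mem _
      refine Submodule.smul_mem _ _ (Submodule.subset_span ⟨p, ?_, rfl⟩)
      by_contra hlt
      have hlt : (k : ℕ) ≤ p := not_lt.1 hlt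
      apply hck
      simp only [hc]
      split_ifs with hkp
      · rfl
      have hkp' : (k : ℕ) ≠ p := fun h => hkp (Fin.ext h)
      rw [div_eq_zero_iff]
      left
      by_cases hk0 : (k : ℕ) = 0
      · rw [← e.sum_repr v, map_sum]
        refine Finset.sum_eq_zero fun j _ => ?_
        rw [map_smul, form_basis_eq_zero halt he (by omega), smul_zero]
      · have hq : (k : ℕ) + ((⟨2 * n + 1 - k, by omega⟩ : Fin (2 * n + 1)) : ℕ) = 2 * n + 1 := by
          simp only; omega
        rw [form_basis_left halt he hq, hgt _ (by simp only; omega), zero_mul]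
  have hform : ∀ i j, ω (b i) (b j) = ω (e i) (e j) := by
    intro i j
    by_cases hi : i = m <;> by_cases hj : j = m
    · rw [hi, hj, halt, halt]
    · rw [hi, hbm, ← halt.neg_eq, hbv j hj, halt.neg_eq]
    · rw [hj, hbm, hbv i hi]
    · rw [hbk i hi, hbk j hj]
      simp [horth j hj, horth' i hi, horth p hpm]
  obtain ⟨g, hg, hge⟩ := exists_borel_of_unitriangular htri hform
  refine ⟨g, hg, (hge m).trans hbm, fun k hk hkv => ?_⟩
  rw [hge, hbk k hk]
  simp [hc, hkv]

/-- If a coordinate subspace `W` has codimension one in an isotropic subspace `V`, then an element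
of the Borel subgroup fixing `W` pointwise maps `V` to a coordinate subspace. -/
lemma exists_borel_map_eq_span (halt : ω.IsAlt)
    (he : ∀ i j : Fin (2 * n + 1), (i : ℕ) < (j : ℕ) →
      ω (e i) (e j) = if (i : ℕ) + (j : ℕ) = 2 * n + 1 then 1 else 0)
    {V W : Submodule ℂ E} (hWV : W ≤ V) (hV : IsIsotropic ω V)
    (hdim : finrank ℂ V = finrank ℂ W + 1) {T : Set (Fin (2 * n + 1))}
    (hW : W = Submodule.span ℂ (e '' T)) :
    ∃ h ∈ borelGroup n ω e, (∀ w ∈ W, h w = w) ∧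
      ∃ T' : Set (Fin (2 * n + 1)),
        Submodule.map (h : E →ₗ[ℂ] E) V = Submodule.span ℂ (e '' T') := by
  classical
  have : FiniteDimensional ℂ E := e.finiteDimensional_of_finite
  have heW : ∀ k ∈ T, e k ∈ W := fun k hk => hW ▸ Submodule.subset_span ⟨k, hk, rfl⟩
  obtain ⟨x, hxV, hxW⟩ : ∃ x ∈ V, x ∉ W := by
    by_contra! h
    have := Submodule.finrank_mono (show V ≤ W from h)
    omega
  obtain ⟨y, hyV, hy0, hyT⟩ : ∃ y ∈ V, y ≠ 0 ∧ ∀ k ∈ T, e.repr y k = 0 := by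
    set z : E := ∑ k ∈ Finset.univ.filter (· ∈ T), e.repr x k • e k with hz
    have hzW : z ∈ W := sum_mem fun k hk =>
      Submodule.smul_mem _ _ (heW k (Finset.mem_filter.1 hk).2)
    refine ⟨x - z, sub_mem hxV (hWV hzW), fun h => hxW ?_, fun k hk => ?_⟩
    · rwa [sub_eq_zero.1 h]
    · simp [hz, Finsupp.single_apply, hk]
  have hne : (e.repr y).support.Nonempty := by
    rw [Finsupp.support_nonempty_iff]
    simpa using hy0
  set m := (e.repr y).support.max' hne with hm
  have hym : e.repr y m ≠ 0 := Finsupp.mem_support_iff.1 (Finset.max'_mem _ hne)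
  have hymax : ∀ k, m < k → e.repr y k = 0 := fun k hk => by
    by_contra h
    exact absurd (Finset.le_max' _ k (Finsupp.mem_support_iff.2 h)) (not_le.2 hk)
  have hmT : m ∉ T := fun h => hym (hyT m h)
  set v : E := (e.repr y m)⁻¹ • y with hv
  have hvV : v ∈ V := Submodule.smul_mem _ _ hyV
  have hvm : v - e m ∈ Efl n e m := by
    rw [mem_Efl_iff]
    intro k hk
    rcases eq_or_lt_of_le (show m ≤ k from hk) with rfl | hlt
    · simp [hv, hym]
    · simp [hv, hymax k hlt, hlt.ne]
  have hvrepr : e.repr v m = 1 := by simp [hv, hym]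
  have hvW : v ∉ W := by
    rw [hW, Basis.mem_span_image]
    intro h
    exact hmT (h (Finsupp.mem_support_iff.2 (by rw [hvrepr]; exact one_ne_zero)))
  have hsup : V = W ⊔ Submodule.span ℂ {v} := by
    symm
    have hle : W ⊔ Submodule.span ℂ {v} ≤ V :=
      sup_le hWV ((Submodule.span_singleton_le_iff_mem _ _).2 hvV)
    refine Submodule.eq_of_le_of_finrank_le hle ?_
    have hlt : W < W ⊔ Submodule.span ℂ {v} := by
      refine lt_of_le_of_ne le_sup_left fun h => hvW ?_
      rw [h]
      exact Submodule.mem_sup_right (Submodule.mem_span_singleton_self v)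
    have := Submodule.finrank_lt_finrank_of_lt hlt
    omega
  obtain ⟨g, hg, hgm, hgT⟩ : ∃ g ∈ borelGroup n ω e, g (e m) = v ∧ ∀ k ∈ T, g (e k) = e k := by
    rcases Nat.eq_zero_or_pos (m : ℕ) with h0 | h0
    · refine ⟨1, one_mem _, ?_, fun _ _ => rfl⟩
      have : v - e m = 0 := by simpa [h0, Efl] using hvm
      exact (sub_eq_zero.1 this).symm
    · obtain ⟨g, hg, hgm, hgk⟩ := exists_borel_map_basis halt he h0 hvm
      exact ⟨g, hg, hgm, fun k hk =>
        hgk k (fun h => hmT (h ▸ hk)) (hV _ (hWV (heW k hk)) _ hvV)⟩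
  have hinv : ∀ {a b : E}, g a = b → (g⁻¹ : E ≃ₗ[ℂ] E) b = a := fun {a b} h =>
    g.symm_apply_eq.2 h.symm
  have hWfix : ∀ w ∈ W, (g⁻¹ : E ≃ₗ[ℂ] E) w = w := by
    intro w hw
    rw [hW] at hw
    exact LinearMap.eqOn_span (f := ((g⁻¹ : E ≃ₗ[ℂ] E) : E →ₗ[ℂ] E)) (g := LinearMap.id)
      (by rintro _ ⟨k, hk, rfl⟩; exact hinv (hgT k hk)) hw
  refine ⟨g⁻¹, inv_mem hg, hWfix, insert m T, ?_⟩
  have hmapW : Submodule.map ((g⁻¹ : E ≃ₗ[ℂ] E) : E →ₗ[ℂ] E) W = W := by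
    ext w
    constructor
    · rintro ⟨u, hu, rfl⟩
      exact (hWfix u hu).symm ▸ hu
    · exact fun hw => ⟨w, hw, hWfix w hw⟩
  rw [hsup, Submodule.map_sup, hmapW, Submodule.map_span, Set.image_singleton,
    show ((g⁻¹ : E ≃ₗ[ℂ] E) : E →ₗ[ℂ] E) v = e m from hinv hgm, hW, Set.image_insert_eq,
    Submodule.span_insert, sup_comm]

/-- The Borel subgroup moves every complete isotropic flag to a coordinate flag. -/
lemma IsIsoFlag.exists_borel_map_eq_span (halt : ω.IsAlt)
    (he : ∀ i j : Fin (2 * n + 1), (i : ℕ) < (j : ℕ) →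
      ω (e i) (e j) = if (i : ℕ) + (j : ℕ) = 2 * n + 1 then 1 else 0)
    {V : Fin (n + 1) → Submodule ℂ E} (hV : IsIsoFlag n ω V) :
    ∃ h ∈ borelGroup n ω e, ∀ k, ∃ T : Set (Fin (2 * n + 1)),
      Submodule.map (h : E →ₗ[ℂ] E) (V k) = Submodule.span ℂ (e '' T) := by
  obtain ⟨hmono, hrank, hiso⟩ := hV
  suffices H : ∀ i ≤ n + 1, ∃ h ∈ borelGroup n ω e, ∀ k : Fin (n + 1), (k : ℕ) < i →
      ∃ T : Set (Fin (2 * n + 1)),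
        Submodule.map (h : E →ₗ[ℂ] E) (V k) = Submodule.span ℂ (e '' T) by
    obtain ⟨h, hh, hT⟩ := H (n + 1) le_rfl
    exact ⟨h, hh, fun k => hT k k.2⟩
  intro i
  induction i with
  | zero => exact fun _ => ⟨1, one_mem _, fun k hk => absurd hk (Nat.not_lt_zero _)⟩
  | succ i ih =>
    intro hi
    obtain ⟨h, hh, hT⟩ := ih (by omega)
    set q : Fin (n + 1) := ⟨i, hi⟩ with hq
    have hrank' : ∀ k, finrank ℂ (Submodule.map (h : E →ₗ[ℂ] E) (V k)) = (k : ℕ) + 1 :=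
      fun k => (LinearEquiv.finrank_map_eq h (V k)).trans (hrank k)
    obtain ⟨W, T, hW, hWq, hWr, hWk⟩ : ∃ (W : Submodule ℂ E) (T : Set (Fin (2 * n + 1))),
        W = Submodule.span ℂ (e '' T) ∧ W ≤ Submodule.map (h : E →ₗ[ℂ] E) (V q) ∧
        finrank ℂ W = i ∧
        ∀ k : Fin (n + 1), (k : ℕ) < i → Submodule.map (h : E →ₗ[ℂ] E) (V k) ≤ W := by
      rcases Nat.eq_zero_or_pos i with h0 | h0
      · exact ⟨⊥, ∅, by simp, bot_le, by simp [h0], fun k hk => by omega⟩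
      · set r : Fin (n + 1) := ⟨i - 1, by omega⟩ with hr
        obtain ⟨T, hT⟩ := hT r (by simp only [hr]; omega)
        refine ⟨_, T, hT, Submodule.map_mono (hmono r q ?_), ?_, fun k hk =>
          Submodule.map_mono (hmono k r ?_)⟩
        · simp only [hr, hq, Fin.mk_le_mk]; omega
        · rw [hrank' r]; simp only [hr]; omega
        · rw [Fin.le_def]; simp only [hr]; omega
    have hisoq : IsIsotropic ω (Submodule.map (h : E →ₗ[ℂ] E) (V q)) := by
      rintro _ ⟨x, hx, rfl⟩ _ ⟨y, hy, rfl⟩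
      exact (hh.1 x y).trans (hiso q x hx y hy)
    obtain ⟨h', hh', hfix, T', hT'⟩ := _root_.exists_borel_map_eq_span halt he hWq hisoq
      (by rw [hrank', hWr]) hW
    have hcomp : ∀ k, Submodule.map ((h' * h : E ≃ₗ[ℂ] E) : E →ₗ[ℂ] E) (V k) =
        Submodule.map (h' : E →ₗ[ℂ] E) (Submodule.map (h : E →ₗ[ℂ] E) (V k)) :=
      fun k => Submodule.map_comp _ _ _
    refine ⟨h' * h, mul_mem hh' hh, fun k hk => ?_⟩
    rw [hcomp]
    rcases Nat.lt_succ_iff_lt_or_eq.1 hk with hk | hk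
    · obtain ⟨S, hS⟩ := hT k hk
      refine ⟨S, Eq.trans ?_ hS⟩
      have hkW := hWk k hk
      ext w
      constructor
      · rintro ⟨u, hu, rfl⟩
        exact (hfix u (hkW hu)).symm ▸ hu
      · exact fun hw => ⟨w, hw, hfix w (hkW hw)⟩
    · rw [show k = q from Fin.ext hk]
      exact ⟨T', hT'⟩

lemma map_inf_Efl {g : E ≃ₗ[ℂ] E} (hg : g ∈ borelGroup n ω e) (V : Submodule ℂ E) {j : ℕ}
    (hj : j ≤ 2 * n + 1) :
    Submodule.map (g : E →ₗ[ℂ] E) (V ⊓ Efl n e j) =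
      Submodule.map (g : E →ₗ[ℂ] E) V ⊓ Efl n e j := by
  rw [Submodule.map_inf _ g.injective, hg.2 j hj]

lemma finrank_map_inf_Efl {g : E ≃ₗ[ℂ] E} (hg : g ∈ borelGroup n ω e) (V : Submodule ℂ E) {j : ℕ}
    (hj : j ≤ 2 * n + 1) :
    finrank ℂ ↥(Submodule.map (g : E →ₗ[ℂ] E) V ⊓ Efl n e j) = finrank ℂ ↥(V ⊓ Efl n e j) := by
  rw [← map_inf_Efl hg V hj]
  exact LinearEquiv.finrank_map_eq g _

lemma finrank_span_inf_Efl (T : Set (Fin (2 * n + 1))) (j : ℕ) :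
    finrank ℂ ↥(Submodule.span ℂ (e '' T) ⊓ Efl n e j) =
      (T ∩ {i : Fin (2 * n + 1) | (i : ℕ) < j}).ncard := by
  classical
  have h : Submodule.span ℂ (e '' T) ⊓ Efl n e j =
      Submodule.span ℂ (e '' (T ∩ {i : Fin (2 * n + 1) | (i : ℕ) < j})) := by
    ext x
    rw [Submodule.mem_inf, Efl, Basis.mem_span_image, Basis.mem_span_image, Basis.mem_span_image,
      Set.subset_inter_iff]
  rw [h, finrank_span_set_eq_card (e.linearIndependent.linearIndepOn _).id_image,
    ← Set.ncard_eq_toFinset_card', Set.ncard_image_of_injective _ e.injective]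

/-- A set of indices is determined by the sizes of its intersections with initial segments. -/
lemma eq_of_ncard_inter_lt {N : ℕ} {T T' : Set (Fin N)}
    (h : ∀ j ≤ N, (T ∩ {i : Fin N | (i : ℕ) < j}).ncard =
      (T' ∩ {i : Fin N | (i : ℕ) < j}).ncard) : T = T' := by
  have key : ∀ (S : Set (Fin N)) (k : Fin N), k ∈ S ↔
      (S ∩ {i : Fin N | (i : ℕ) < k}).ncard < (S ∩ {i : Fin N | (i : ℕ) < k + 1}).ncard := by
    intro S k
    have hsub : S ∩ {i : Fin N | (i : ℕ) < k} ⊆ S ∩ {i : Fin N | (i : ℕ) < k + 1} :=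
      fun i hi => ⟨hi.1, Nat.lt_succ_of_lt hi.2⟩
    constructor
    · intro hk
      refine Set.ncard_lt_ncard (hsub.ssubset_of_mem_notMem (a := k) ?_ ?_)
      · exact ⟨hk, Nat.lt_succ_self _⟩
      · exact fun h => lt_irrefl (k : ℕ) h.2
    · intro hlt
      by_contra hk
      refine hlt.not_ge (Set.ncard_le_ncard ?_)
      rintro i ⟨hi, hik⟩
      refine ⟨hi, lt_of_le_of_ne (Nat.lt_succ_iff.1 hik) fun h => hk ?_⟩
      rwa [← Fin.ext h]
  ext k
  rw [key T k, key T' k, h k k.2.le, h (k + 1) k.2]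

end BorelOrbits

/-- Let `B` be the Borel subgroup of the odd symplectic group of
elements preserving the reference flag `E_•`.  Two complete isotropic flags `V_•, V'_•`
of `E` lie in the same `B`-orbit if and only if `dim(V_i ∩ E_j) = dim(V'_i ∩ E_j)` for
all `1 ≤ i ≤ n+1` and all `1 ≤ j ≤ 2n+1`. -/
theorem schubert_cells_are_borel_orbits_flags
    (n : ℕ) (hn : 1 ≤ n)
    [FiniteDimensional ℂ E] (hdim : finrank ℂ E = 2 * n + 1)
    (ω : LinearMap.BilinForm ℂ E) (halt : ω.IsAlt)
    (e : Basis (Fin (2 * n + 1)) ℂ E)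
    (he : ∀ i j : Fin (2 * n + 1), (i : ℕ) < (j : ℕ) →
      ω (e i) (e j) = if (i : ℕ) + (j : ℕ) = 2 * n + 1 then 1 else 0) :
    ∀ V V' : Fin (n + 1) → Submodule ℂ E,
      IsIsoFlag n ω V → IsIsoFlag n ω V' →
      ((∃ g ∈ sympGroup ω,
          (∀ j : ℕ, j ≤ 2 * n + 1 →
            Submodule.map ((g : E ≃ₗ[ℂ] E) : E →ₗ[ℂ] E) (Efl n e j) = Efl n e j) ∧
          ∀ i : Fin (n + 1),
            Submodule.map ((g : E ≃ₗ[ℂ] E) : E →ₗ[ℂ] E) (V i) = V' i) ↔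
        (∀ i : Fin (n + 1), ∀ j : ℕ, 1 ≤ j → j ≤ 2 * n + 1 →
          finrank ℂ ↥(V i ⊓ Efl n e j) = finrank ℂ ↥(V' i ⊓ Efl n e j))) := by
  intro V V' hV hV'
  constructor
  · rintro ⟨g, hg, hgE, hgV⟩ i j - hj
    rw [← hgV i, finrank_map_inf_Efl (ω := ω) ⟨hg, hgE⟩ (V i) hj]
  · intro hrank
    obtain ⟨h, hh, hT⟩ := hV.exists_borel_map_eq_span halt he
    obtain ⟨h', hh', hT'⟩ := hV'.exists_borel_map_eq_span halt he
    have hmap : ∀ i, Submodule.map (h : E →ₗ[ℂ] E) (V i) =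
        Submodule.map (h' : E →ₗ[ℂ] E) (V' i) := by
      intro i
      obtain ⟨T, hT⟩ := hT i
      obtain ⟨T', hT'⟩ := hT' i
      rw [hT, hT', eq_of_ncard_inter_lt (T := T) (T' := T')]
      intro j hj
      rw [← finrank_span_inf_Efl (e := e), ← finrank_span_inf_Efl (e := e), ← hT, ← hT',
        finrank_map_inf_Efl hh _ hj, finrank_map_inf_Efl hh' _ hj]
      rcases Nat.eq_zero_or_pos j with rfl | h0
      · rw [show Efl n e 0 = ⊥ by simp [Efl], inf_bot_eq, inf_bot_eq]
      · exact hrank i j h0 hj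
    obtain ⟨hg, hgE⟩ := mul_mem (inv_mem hh') hh
    refine ⟨h'⁻¹ * h, hg, hgE, fun i => ?_⟩
    rw [show ((h'⁻¹ * h : E ≃ₗ[ℂ] E) : E →ₗ[ℂ] E) =
      ((h'⁻¹ : E ≃ₗ[ℂ] E) : E →ₗ[ℂ] E) ∘ₗ (h : E →ₗ[ℂ] E) from rfl, Submodule.map_comp, hmap,
      ← Submodule.map_comp, show ((h'⁻¹ : E ≃ₗ[ℂ] E) : E →ₗ[ℂ] E) ∘ₗ (h' : E →ₗ[ℂ] E) =
      LinearMap.id from LinearMap.ext fun x => h'.symm_apply_apply x, Submodule.map_id]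


end
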